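/- There exist a first-order language L and a set T₀ of quasi-identities in L such that the lattice QTh(T₀) of quasi-equational theories extending T₀, ordered by inclusion, is order-isomorphic to the poset 1 +̇ (ω* × 2), i.e., the direct product of the dual order of ℕ with the two-element chain, with one new least element adjoined below everything. -/

import Mathlib

open FirstOrder FirstOrder.Language

universe u v

/-- A quasi-identity whose matrix has `n` universally quantified variables. -/
def IsQuasiIdentityN {L : FirstOrder.Language.{u, v}} (n : ℕ) (σ : L.Sentence) : Prop :=
  ∃ (hyps : List (L.BoundedFormula Empty n)) (concl : L.BoundedFormula Empty n),
    (∀ φ ∈ hyps, φ.IsAtomic) ∧ concl.IsAtomic ∧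
      σ = BoundedFormula.alls ((hyps.foldr (· ⊓ ·) ⊤).imp concl)

/-- A quasi-identity: the universal closure of an implication whose premise is a
finite (possibly empty) conjunction of atomic formulas and whose conclusion is an
atomic formula. -/
def IsQuasiIdentity {L : FirstOrder.Language.{u, v}} (σ : L.Sentence) : Prop :=
  ∃ n, IsQuasiIdentityN n σ

/-- A quasi-equational theory extending `T₀`: a set `T` of quasi-identities
containing `T₀` such that every quasi-identity true in all models of `T` belongs
to `T`. -/
def IsQETheory {L : FirstOrder.Language.{u, v}} (T₀ T : L.Theory) : Prop :=
  T₀ ⊆ T ∧ (∀ σ ∈ T, IsQuasiIdentity σ) ∧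
    ∀ σ : L.Sentence, IsQuasiIdentity σ → T ⊨ᵇ σ → σ ∈ T

/-- The function symbols of the language of abelian groups. -/
inductive AddGroupFunc : ℕ → Type u
  | zero : AddGroupFunc 0
  | neg : AddGroupFunc 1
  | add : AddGroupFunc 2

/-- The language of additive groups, with no relation symbols besides equality. -/
def addGroupLang : FirstOrder.Language.{u, v} :=
  ⟨AddGroupFunc, fun _ => PEmpty⟩

namespace addGroupLang

instance structureOfAddCommGroup {M : Type*} [AddCommGroup M] :
    addGroupLang.{u, v}.Structure M where
  funMap {n} f a := match n, f, a with
    | _, AddGroupFunc.zero, _ => 0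
    | _, AddGroupFunc.neg, a => -a 0
    | _, AddGroupFunc.add, a => a 0 + a 1
  RelMap := fun r => nomatch r

variable {α : Type*}

/-- The term `0`. -/
def zeroTerm : addGroupLang.{u, v}.Term α :=
  .func (l := 0) AddGroupFunc.zero ![]

/-- The term `-t`. -/
def negTerm (t : addGroupLang.{u, v}.Term α) : addGroupLang.{u, v}.Term α :=
  .func (l := 1) AddGroupFunc.neg ![t]

/-- The term `s + t`. -/
def addTerm (s t : addGroupLang.{u, v}.Term α) : addGroupLang.{u, v}.Term α :=
  .func (l := 2) AddGroupFunc.add ![s, t]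

/-- The term `k • t`. -/
def nsmulTerm : ℕ → addGroupLang.{u, v}.Term α → addGroupLang.{u, v}.Term α
  | 0, _ => zeroTerm
  | k + 1, t => addTerm (nsmulTerm k t) t

section Group

variable {M N : Type*} [AddCommGroup M] [AddCommGroup N] (v : α → M)

@[simp]
theorem realize_zeroTerm : (zeroTerm : addGroupLang.{u, v}.Term α).realize v = 0 := rfl

@[simp]
theorem realize_negTerm (t : addGroupLang.{u, v}.Term α) :
    (negTerm t).realize v = -t.realize v := rfl

@[simp]
theorem realize_addTerm (s t : addGroupLang.{u, v}.Term α) :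
    (addTerm s t).realize v = s.realize v + t.realize v := rfl

@[simp]
theorem realize_nsmulTerm (k : ℕ) (t : addGroupLang.{u, v}.Term α) :
    (nsmulTerm k t).realize v = k • t.realize v := by
  induction k with
  | zero => simp [nsmulTerm]
  | succ k ih => simp [nsmulTerm, ih, succ_nsmul]

/-- A homomorphism of abelian groups as a homomorphism of first-order structures. -/
def homOfAddMonoidHom (f : M →+ N) : M →[addGroupLang.{u, v}] N where
  toFun := f
  map_fun' := by
    rintro _ (_ | _ | _) a
    · exact map_zero f
    · exact map_neg f _
    · exact map_add f _ _
  map_rel' := fun r => nomatch r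

theorem realize_comp_addMonoidHom (f : M →+ N) (t : addGroupLang.{u, v}.Term α) :
    t.realize (f ∘ v) = f (t.realize v) :=
  HomClass.realize_term (homOfAddMonoidHom f)

end Group

theorem realize_alls_iff {L : FirstOrder.Language.{u, v}} {M : Type*} [L.Structure M] {n : ℕ}
    (φ : L.BoundedFormula Empty n) :
    Sentence.Realize M φ.alls ↔ ∀ xs : Fin n → M, φ.Realize isEmptyElim xs := by
  rw [Subsingleton.elim (isEmptyElim : Empty → M) default]
  exact BoundedFormula.realize_alls

/-- A term equation with variables indexed by `Fin n`, as a quasi-identity without premises. -/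
def identity {n : ℕ} (s t : addGroupLang.{u, v}.Term (Empty ⊕ Fin n)) :
    addGroupLang.{u, v}.Sentence :=
  BoundedFormula.alls ((([] : List (addGroupLang.{u, v}.BoundedFormula Empty n)).foldr
    (· ⊓ ·) ⊤).imp (s.bdEqual t))

theorem isQuasiIdentity_identity {n : ℕ} (s t : addGroupLang.{u, v}.Term (Empty ⊕ Fin n)) :
    IsQuasiIdentity (identity s t) :=
  ⟨n, [], _, by simp, .equal s t, rfl⟩

theorem realize_identity {M : Type*} [addGroupLang.{u, v}.Structure M] {n : ℕ}
    (s t : addGroupLang.{u, v}.Term (Empty ⊕ Fin n)) :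
    M ⊨ identity s t ↔ ∀ xs : Fin n → M,
      s.realize (Sum.elim isEmptyElim xs) = t.realize (Sum.elim isEmptyElim xs) := by
  simp [identity, realize_alls_iff]

/-- The quasi-identity `k • x = 0 → l • x = 0`. -/
def torsionImp (k l : ℕ) : addGroupLang.{u, v}.Sentence :=
  BoundedFormula.alls (([(nsmulTerm k (&0)).bdEqual zeroTerm].foldr (· ⊓ ·) ⊤).imp
    ((nsmulTerm l (&0)).bdEqual zeroTerm) : addGroupLang.{u, v}.BoundedFormula Empty 1)

theorem isQuasiIdentity_torsionImp (k l : ℕ) :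
    IsQuasiIdentity (torsionImp.{u, v} k l) :=
  ⟨1, [(nsmulTerm k (&0)).bdEqual zeroTerm], _,
    by simpa using BoundedFormula.IsAtomic.equal _ _, .equal _ _, rfl⟩

theorem realize_torsionImp {M : Type*} [AddCommGroup M] (k l : ℕ) :
    M ⊨ torsionImp.{u, v} k l ↔ ∀ x : M, k • x = 0 → l • x = 0 := by
  simp only [torsionImp, realize_alls_iff,
    BoundedFormula.realize_imp, BoundedFormula.realize_foldr_inf, List.mem_singleton, forall_eq,
    BoundedFormula.realize_bdEqual, realize_nsmulTerm, realize_zeroTerm]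
  exact ⟨fun h x => h fun _ => x, fun h xs => h (xs 0)⟩

section Preservation

variable {σ : addGroupLang.{u, v}.Sentence}

/-- A quasi-identity holds in an abelian group as soon as it holds in enough homomorphic images
of each of its finitely generated subgroups. -/
theorem realize_of_fg_separated {M : Type*} [AddCommGroup M] (hσ : IsQuasiIdentity σ)
    (h : ∀ H : AddSubgroup M, H.FG → ∀ x : H, x ≠ 0 →
      ∃ (N : Type*) (_ : AddCommGroup N) (f : H →+ N), f x ≠ 0 ∧ N ⊨ σ) : M ⊨ σ := by
  obtain ⟨n, hyps, concl, hh, hc, rfl⟩ := hσ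
  simp only [realize_alls_iff,
    BoundedFormula.realize_imp, BoundedFormula.realize_foldr_inf] at h ⊢
  intro xs hxs
  let H := AddSubgroup.closure (Set.range xs)
  let ys : Fin n → H := fun i => ⟨xs i, AddSubgroup.subset_closure ⟨i, rfl⟩⟩
  have hval (t : addGroupLang.{u, v}.Term (Empty ⊕ Fin n)) :
      t.realize (Sum.elim isEmptyElim xs) = (t.realize (Sum.elim isEmptyElim ys) : H) := by
    rw [← AddSubgroup.subtype_apply, ← realize_comp_addMonoidHom, Sum.comp_elim]
    congr 1
    exact congrArg (Sum.elim · _) (Subsingleton.elim _ _)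
  obtain ⟨s, t⟩ | ⟨r, _⟩ := hc
  swap
  · exact nomatch r
  rw [BoundedFormula.realize_bdEqual, hval, hval]
  by_contra hne
  obtain ⟨N, _, f, hf, hN⟩ := h H ((AddSubgroup.fg_iff H).2 ⟨_, rfl, Set.finite_range xs⟩)
    (s.realize (Sum.elim isEmptyElim ys) - t.realize (Sum.elim isEmptyElim ys))
    (fun h0 => hne (congrArg _ (sub_eq_zero.1 h0)))
  have hmap (t : addGroupLang.{u, v}.Term (Empty ⊕ Fin n)) :
      t.realize (Sum.elim isEmptyElim (f ∘ ys)) = f (t.realize (Sum.elim isEmptyElim ys)) := by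
    rw [← realize_comp_addMonoidHom, Sum.comp_elim]
    congr 1
    exact congrArg (Sum.elim · _) (Subsingleton.elim _ _)
  specialize hN (f ∘ ys) fun φ hφ => ?_
  · have := hxs φ hφ
    obtain ⟨s, t⟩ | ⟨r, _⟩ := hh φ hφ
    · rw [BoundedFormula.realize_bdEqual, hval, hval] at this
      rw [BoundedFormula.realize_bdEqual, hmap, hmap, Subtype.val_injective this]
    · exact nomatch r
  · rw [BoundedFormula.realize_bdEqual, hmap, hmap] at hN
    exact hf (by rw [map_sub, hN, sub_self])

theorem realize_of_separated {M : Type*} [AddCommGroup M] (hσ : IsQuasiIdentity σ)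
    (h : ∀ x : M, x ≠ 0 →
      ∃ (N : Type*) (_ : AddCommGroup N) (f : M →+ N), f x ≠ 0 ∧ N ⊨ σ) : M ⊨ σ :=
  realize_of_fg_separated hσ fun _ _ x hx => by
    obtain ⟨N, i, f, hf, hN⟩ := h x (by simpa using hx)
    exact ⟨N, i, f.comp (AddSubgroup.subtype _), hf, hN⟩

theorem realize_of_injective {M N : Type*} [AddCommGroup M] [AddCommGroup N]
    (hσ : IsQuasiIdentity σ) (f : M →+ N) (hf : Function.Injective f) (hN : N ⊨ σ) : M ⊨ σ :=
  realize_of_separated hσ fun _ hx =>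
    ⟨N, inferInstance, f, (map_ne_zero_iff f hf).2 hx, hN⟩

end Preservation

/-- The orders of the generating cyclic groups: `0` for `ℤ`, and the powers of `2`. -/
def cyclicOrder : Option ℕ → ℕ
  | none => 0
  | some k => 2 ^ k

theorem realize_of_cyclic {M : Type*} [AddCommGroup M] {σ : addGroupLang.{u, v}.Sentence}
    (hσ : IsQuasiIdentity σ) (hM : ∀ k : ℕ, Odd k → ∀ x : M, k • x = 0 → x = 0)
    (h : ∀ (i : Option ℕ) (f : ZMod (cyclicOrder i) →+ M), Function.Injective f →
      ZMod (cyclicOrder i) ⊨ σ) : M ⊨ σ := by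
  classical
  refine realize_of_fg_separated hσ fun H hH _ hx => ?_
  have : AddGroup.FG H := (AddGroup.fg_iff_addSubgroup_fg H).2 hH
  obtain ⟨n, ι, _, p, hp, e, ⟨g⟩⟩ := AddCommGroup.equiv_free_prod_directSum_zmod H
  have hinj := Subtype.val_injective.comp g.symm.injective
  have hgx := (map_ne_zero_iff g g.injective).2 hx
  rw [Ne, Prod.ext_iff, not_and_or, Finsupp.ext_iff, DFinsupp.ext_iff, not_forall,
    not_forall] at hgx
  obtain ⟨a, ha⟩ | ⟨i, hi⟩ := hgx
  · exact ⟨ZMod (cyclicOrder none), inferInstance,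
      ((Finsupp.applyAddHom a).comp (AddMonoidHom.fst _ _)).comp g.toAddMonoidHom, ha,
      h none (((H.subtype.comp g.symm.toAddMonoidHom).comp (AddMonoidHom.inl _ _)).comp
        (Finsupp.singleAddHom a)) (hinj.comp ((Prod.mk_left_injective _).comp
          (Finsupp.single_injective a)))⟩
  · let f : ZMod (p i ^ e i) →+ M :=
      ((H.subtype.comp g.symm.toAddMonoidHom).comp (AddMonoidHom.inr _ _)).comp
        (DirectSum.of (fun i => ZMod (p i ^ e i)) i)
    have hf : Function.Injective f :=
      hinj.comp ((Prod.mk_right_injective _).comp (DirectSum.of_injective i))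
    have hpow : ∃ k, p i ^ e i = cyclicOrder (some k) := by
      obtain hp2 | hodd := (hp i).eq_two_or_odd'
      · exact ⟨e i, by rw [hp2]; rfl⟩
      · have h1 : (1 : ZMod (p i ^ e i)) = 0 := hf (by
          rw [map_zero]
          refine hM _ (hodd.pow (n := e i)) _ ?_
          rw [← map_nsmul, nsmul_one, ZMod.natCast_self, map_zero])
        refine ⟨0, ?_⟩
        have := (ZMod.natCast_eq_zero_iff 1 (p i ^ e i)).1 (by simpa using h1)
        simpa [cyclicOrder] using this
    obtain ⟨k, hk⟩ := hpow
    refine ⟨ZMod (p i ^ e i), inferInstance,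
      ((DFinsupp.evalAddMonoidHom i).comp (AddMonoidHom.snd _ _)).comp g.toAddMonoidHom, hi, ?_⟩
    clear_value f
    clear hi
    revert f
    rw [hk]
    exact fun f hf => h _ f hf

/-- The quasi-identities true in all the cyclic groups with index in `I`. -/
def cyclicTheory (I : Set (Option ℕ)) : addGroupLang.{u, v}.Theory :=
  {σ | IsQuasiIdentity σ ∧ ∀ i ∈ I, ZMod (cyclicOrder i) ⊨ σ}

theorem cyclic_models_cyclicTheory {I : Set (Option ℕ)} {i : Option ℕ} (hi : i ∈ I) :
    ZMod (cyclicOrder i) ⊨ cyclicTheory.{u, v} I :=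
  ⟨fun _ hσ => hσ.2 i hi⟩

theorem isQETheory_cyclicTheory (I : Set (Option ℕ)) :
    IsQETheory (cyclicTheory.{u, v} Set.univ) (cyclicTheory I) := by
  refine ⟨fun σ hσ => ⟨hσ.1, fun i _ => hσ.2 i trivial⟩, fun σ hσ => hσ.1,
    fun σ hσ hI => ⟨hσ, fun i hi => ?_⟩⟩
  have := cyclic_models_cyclicTheory.{u, v} hi
  exact hI.realize_sentence _

theorem zmod_realize_torsionImp {m k l : ℕ} :
    ZMod m ⊨ torsionImp.{u, v} k l ↔ ∀ z : ℤ, (m : ℤ) ∣ k * z → (m : ℤ) ∣ l * z := by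
  rw [realize_torsionImp, ZMod.intCast_surjective.forall]
  simp [nsmul_eq_mul, ← ZMod.intCast_zmod_eq_zero_iff_dvd]

theorem zmod_realize_torsionImp_odd (i : Option ℕ) {k : ℕ} (hk : Odd k) :
    ZMod (cyclicOrder i) ⊨ torsionImp.{u, v} k 1 := by
  rw [zmod_realize_torsionImp]
  intro z hz
  rw [Nat.cast_one, one_mul]
  cases i with
  | none => simpa [cyclicOrder, hk.pos.ne'] using hz
  | some n =>
    exact (Nat.isCoprime_iff_coprime.2
      (Nat.Coprime.pow_left n hk.coprime_two_left)).dvd_of_dvd_mul_left hz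

/-- Every model of the quasi-identities common to all the cyclic groups is an abelian group
without odd torsion. -/
theorem exists_addCommGroup {M : Type*} [inst : addGroupLang.{u, v}.Structure M]
    (hM : M ⊨ cyclicTheory.{u, v} Set.univ) :
    ∃ g : AddCommGroup M, inst = @structureOfAddCommGroup M g ∧
      ∀ k : ℕ, Odd k → ∀ x : M, k • x = 0 → x = 0 := by
  have hid {n : ℕ} (s t : addGroupLang.{u, v}.Term (Empty ⊕ Fin n))
      (h : ∀ (i : Option ℕ) (xs : Fin n → ZMod (cyclicOrder i)),
        s.realize (Sum.elim isEmptyElim xs) = t.realize (Sum.elim isEmptyElim xs)) (xs : Fin n → M) :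
      s.realize (Sum.elim isEmptyElim xs) = t.realize (Sum.elim isEmptyElim xs) :=
    (realize_identity s t).1 (hM.realize_of_mem _
      ⟨isQuasiIdentity_identity s t, fun i _ => (realize_identity s t).2 (h i)⟩) xs
  let z : M := Structure.funMap (L := addGroupLang.{u, v}) (n := 0) AddGroupFunc.zero ![]
  let neg (a : M) : M := Structure.funMap (L := addGroupLang.{u, v}) (n := 1) AddGroupFunc.neg ![a]
  let add (a b : M) : M :=
    Structure.funMap (L := addGroupLang.{u, v}) (n := 2) AddGroupFunc.add ![a, b]
  have hz {β : Type} (v : β → M) :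
      (zeroTerm : addGroupLang.{u, v}.Term β).realize v = z := by
    simp only [zeroTerm, Term.realize, z]
    exact congrArg _ (Subsingleton.elim _ _)
  have hn {β : Type} (v : β → M) (t : addGroupLang.{u, v}.Term β) :
      (negTerm t).realize v = neg (t.realize v) := by
    simp only [negTerm, Term.realize, neg]
    congr 1
    ext i
    fin_cases i
    rfl
  have ha {β : Type} (v : β → M) (s t : addGroupLang.{u, v}.Term β) :
      (addTerm s t).realize v = add (s.realize v) (t.realize v) := by
    simp only [addTerm, Term.realize, add]
    congr 1
    ext i
    fin_cases i <;> rfl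
  have hassoc (a b c : M) : add (add a b) c = add a (add b c) := by
    simpa [ha] using hid (n := 3) (addTerm (addTerm (&0) (&1)) (&2))
      (addTerm (&0) (addTerm (&1) (&2))) (fun i xs => by simp [add_assoc]) ![a, b, c]
  have hcomm (a b : M) : add a b = add b a := by
    simpa [ha] using hid (n := 2) (addTerm (&0) (&1)) (addTerm (&1) (&0))
      (fun i xs => by simp [add_comm]) ![a, b]
  have hzero (a : M) : add z a = a := by
    simpa [ha, hz] using hid (n := 1) (addTerm zeroTerm (&0)) (&0) (fun i xs => by simp) ![a]
  have hneg (a : M) : add (neg a) a = z := by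
    simpa [ha, hz, hn] using hid (n := 1) (addTerm (negTerm (&0)) (&0)) zeroTerm
      (fun i xs => by simp) ![a]
  let _ : Add M := ⟨add⟩
  let _ : Neg M := ⟨neg⟩
  let _ : Zero M := ⟨z⟩
  let g : AddCommGroup M :=
    { AddGroup.ofLeftAxioms hassoc hzero hneg with add_comm := hcomm }
  have hg : inst = @structureOfAddCommGroup M g := by
    ext n f a
    · obtain _ | _ | _ := f
      · exact congrArg _ (Subsingleton.elim _ _)
      · refine congrArg (Structure.funMap (L := addGroupLang.{u, v}) (n := 1) _) ?_
        ext i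
        fin_cases i
        rfl
      · refine congrArg (Structure.funMap (L := addGroupLang.{u, v}) (n := 2) _) ?_
        ext i
        fin_cases i <;> rfl
    · cases f
  refine ⟨g, hg, fun k hk x hx => ?_⟩
  clear_value g
  subst hg
  have := (realize_torsionImp k 1).1 (hM.realize_of_mem _ ⟨isQuasiIdentity_torsionImp k 1,
    fun i _ => zmod_realize_torsionImp_odd i hk⟩) x hx
  simpa using this

/-- A quasi-equational theory of abelian groups without odd torsion is determined by the cyclic
groups satisfying it. -/
theorem eq_cyclicTheory {T : addGroupLang.{u, v}.Theory}
    (hT : IsQETheory (cyclicTheory Set.univ) T) :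
    T = cyclicTheory {i | ZMod (cyclicOrder i) ⊨ T} := by
  obtain ⟨h0, hqi, hcl⟩ := hT
  refine Set.Subset.antisymm (fun σ hσ => ⟨hqi σ hσ, fun i hi => hi.realize_of_mem σ hσ⟩)
    fun σ hσ => hcl σ hσ.1 ?_
  rw [Theory.models_sentence_iff]
  intro M
  obtain ⟨g, hg, hodd⟩ := exists_addCommGroup (M.is_model.mono h0)
  have hM := M.is_model
  rw [hg] at hM ⊢
  exact realize_of_cyclic hσ.1 hodd fun i f hf =>
    hσ.2 i ⟨fun τ hτ => realize_of_injective (hqi τ hτ) f hf (hM.realize_of_mem τ hτ)⟩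

/-- The index set of the cyclic groups satisfying the theory attached to a point of the
lattice. -/
def indexSet : WithBot (ℕᵒᵈ × Bool) → Set (Option ℕ)
  | ⊥ => Set.univ
  | (a : ℕᵒᵈ × Bool) => {i | i.elim (a.2 = false) (· ≤ OrderDual.ofDual a.1)}

theorem none_mem_indexSet {n : ℕᵒᵈ} {b : Bool} :
    none ∈ indexSet ((n, b) : ℕᵒᵈ × Bool) ↔ b = false := Iff.rfl

theorem some_mem_indexSet {n : ℕᵒᵈ} {b : Bool} {k : ℕ} :
    some k ∈ indexSet ((n, b) : ℕᵒᵈ × Bool) ↔ k ≤ OrderDual.ofDual n := Iff.rfl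

theorem indexSet_subset_iff {x y : WithBot (ℕᵒᵈ × Bool)} :
    indexSet y ⊆ indexSet x ↔ x ≤ y := by
  cases x with
  | bot => exact iff_of_true (Set.subset_univ _) bot_le
  | coe x =>
    obtain ⟨n, b⟩ := x
    cases y with
    | bot =>
      refine iff_of_false (fun h => ?_) (WithBot.not_coe_le_bot _)
      have := some_mem_indexSet.1 (h (Set.mem_univ (some (OrderDual.ofDual n + 1))))
      lia
    | coe y =>
      obtain ⟨m, c⟩ := y
      rw [WithBot.coe_le_coe, Prod.mk_le_mk]
      constructor
      · refine fun h => ⟨some_mem_indexSet.1 (h (some_mem_indexSet.2 le_rfl)), ?_⟩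
        have := fun hc => none_mem_indexSet.1 (h (none_mem_indexSet.2 hc))
        revert this
        cases b <;> cases c <;> decide
      · rintro ⟨hn, hb⟩ (_ | k) hi
        · rw [none_mem_indexSet] at hi ⊢
          subst hi
          exact le_bot_iff.1 hb
        · rw [some_mem_indexSet] at hi ⊢
          exact hi.trans hn

theorem mem_indexSet_of_models {x : WithBot (ℕᵒᵈ × Bool)} {i : Option ℕ}
    (h : ZMod (cyclicOrder i) ⊨ cyclicTheory.{u, v} (indexSet x)) : i ∈ indexSet x := by
  cases x with
  | bot => trivial
  | coe x =>
    obtain ⟨n, b⟩ := x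
    induction n using OrderDual.rec with | _ n
    cases i with
    | none =>
      rw [none_mem_indexSet]
      by_contra hb
      have := zmod_realize_torsionImp.1 (h.realize_of_mem (torsionImp 0 (2 ^ n))
        ⟨isQuasiIdentity_torsionImp _ _, ?_⟩) 1 (by simp)
      · simp [cyclicOrder] at this
      · rintro (_ | k) hk
        · exact absurd (none_mem_indexSet.1 hk) hb
        · refine zmod_realize_torsionImp.2 fun z _ => dvd_mul_of_dvd_left ?_ _
          exact_mod_cast pow_dvd_pow 2 (some_mem_indexSet.1 hk)
    | some k =>
      rw [some_mem_indexSet]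
      by_contra! hk
      obtain ⟨d, rfl⟩ := Nat.exists_eq_add_of_lt hk
      have := zmod_realize_torsionImp.1 (h.realize_of_mem (torsionImp (2 ^ (n + 1)) (2 ^ n))
        ⟨isQuasiIdentity_torsionImp _ _, ?_⟩) (2 ^ d)
        (by simp only [cyclicOrder]; push_cast; exact dvd_of_eq (by simp; ring))
      · have h2 : 2 ^ (n + d + 1) ∣ 2 ^ (n + d) := by
          rw [pow_add 2 n d]
          exact_mod_cast this
        have := (Nat.pow_dvd_pow_iff_le_right (le_refl 2)).1 h2
        lia
      · rintro (_ | k) hk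
        · refine zmod_realize_torsionImp.2 fun z hz => ?_
          simpa [cyclicOrder] using hz
        · refine zmod_realize_torsionImp.2 fun z _ => dvd_mul_of_dvd_left ?_ _
          exact_mod_cast pow_dvd_pow 2 (some_mem_indexSet.1 hk)

theorem exists_zmod_injective {a : ℕ} (b : ℕ) (ha : a ≠ 0) :
    ∃ f : ZMod b →+ ZMod (a * b), Function.Injective f := by
  refine ⟨ZMod.lift b ⟨zmultiplesHom _ (a : ZMod (a * b)), ?_⟩, ?_⟩
  · have := ZMod.natCast_self (a * b)
    push_cast at this
    simpa [mul_comm] using this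
  · rw [ZMod.lift_injective]
    intro z hz
    have : (((a : ℤ) * z : ℤ) : ZMod (a * b)) = 0 := by simpa [mul_comm] using hz
    rw [ZMod.intCast_zmod_eq_zero_iff_dvd] at this ⊢
    push_cast at this
    exact Int.dvd_of_mul_dvd_mul_left (by exact_mod_cast ha) this

theorem exists_indexSet_eq {T : addGroupLang.{u, v}.Theory} (hT : ∀ σ ∈ T, IsQuasiIdentity σ) :
    ∃ x, indexSet x = {i | ZMod (cyclicOrder i) ⊨ T} := by
  classical
  set S := {i | ZMod (cyclicOrder i) ⊨ T}
  have hzero : some 0 ∈ S := ⟨fun σ hσ => realize_of_separated.{u, v, 0, 0} (hT σ hσ)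
    fun x hx => (hx ((ZMod.subsingleton_iff.2 rfl).elim x 0)).elim⟩
  have hdown {j k : ℕ} (hjk : j ≤ k) (hk : some k ∈ S) : some j ∈ S := by
    obtain ⟨d, rfl⟩ := Nat.exists_eq_add_of_le' hjk
    have hk : ZMod (2 ^ (d + j)) ⊨ T := hk
    rw [pow_add] at hk
    obtain ⟨f, hf⟩ := exists_zmod_injective (2 ^ j) (pow_ne_zero d two_ne_zero)
    exact ⟨fun σ hσ => realize_of_injective (hT σ hσ) f hf (hk.realize_of_mem σ hσ)⟩
  by_cases hbdd : ∃ n, some n ∉ S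
  · obtain ⟨n, hn, hn'⟩ : ∃ n, some n ∈ S ∧ some (n + 1) ∉ S := by
      by_contra! h
      obtain ⟨n, hn⟩ := hbdd
      exact hn (Nat.rec hzero (fun n => h n) n)
    refine ⟨((OrderDual.toDual n, decide (none ∉ S)) : ℕᵒᵈ × Bool), ?_⟩
    ext (_ | k)
    · simp [none_mem_indexSet]
    · rw [some_mem_indexSet]
      refine ⟨fun h => hdown h hn, fun h => ?_⟩
      by_contra hk
      exact hn' (hdown (not_le.1 hk) h)
  · push Not at hbdd
    refine ⟨⊥, (Set.eq_univ_of_forall ?_).symm⟩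
    rintro (_ | k)
    · refine ⟨fun σ hσ => realize_of_separated (hT σ hσ) fun x hx => ?_⟩
      obtain ⟨z, rfl⟩ := ZMod.intCast_surjective x
      refine ⟨ZMod (2 ^ z.natAbs), inferInstance,
        (ZMod.castHom (dvd_zero _) (ZMod (2 ^ z.natAbs))).toAddMonoidHom, fun h0 => hx ?_,
        (hbdd z.natAbs).realize_of_mem σ hσ⟩
      have h0 : (z : ZMod (2 ^ z.natAbs)) = 0 := by
        rw [← h0]
        exact (map_intCast (ZMod.castHom (dvd_zero _) (ZMod (2 ^ z.natAbs))) z).symm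
      rw [ZMod.intCast_zmod_eq_zero_iff_dvd] at h0
      rw [Int.eq_zero_of_dvd_of_natAbs_lt_natAbs h0
        (by simpa using Nat.lt_two_pow_self), Int.cast_zero]
    · exact hbdd k

end addGroupLang

/-- There exist a first-order language `L` and a set `T₀` of
quasi-identities in `L` such that the lattice `QTh(T₀)` of quasi-equational
theories extending `T₀`, ordered by inclusion, is order-isomorphic to
`1 +̇ (ω* × 2)`: the direct product of the dual order of `ℕ` with the two-element
chain, with one new least element adjoined below everything. -/
theorem qth_one_plus_omegaStar_times_two :
    ∃ (L : FirstOrder.Language.{u, v}) (T₀ : L.Theory),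
      (∀ σ ∈ T₀, IsQuasiIdentity σ) ∧
      Nonempty ({T : L.Theory // IsQETheory T₀ T} ≃o WithBot (ℕᵒᵈ × Bool)) := by
  open addGroupLang in
  let F (x : WithBot (ℕᵒᵈ × Bool)) :
      {T : addGroupLang.{u, v}.Theory // IsQETheory (cyclicTheory Set.univ) T} :=
    ⟨cyclicTheory (indexSet x), isQETheory_cyclicTheory _⟩
  have hF {x y} : F x ≤ F y ↔ x ≤ y := by
    rw [← indexSet_subset_iff]
    refine ⟨fun h i hi => mem_indexSet_of_models ((cyclic_models_cyclicTheory hi).mono h),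
      fun h σ hσ => ⟨hσ.1, fun i hi => hσ.2 i (h hi)⟩⟩
  have hsurj : Function.Surjective F := fun T => by
    obtain ⟨x, hx⟩ := exists_indexSet_eq T.2.2.1
    exact ⟨x, Subtype.ext (by rw [eq_cyclicTheory T.2, ← hx])⟩
  exact ⟨addGroupLang, cyclicTheory Set.univ, fun σ hσ => hσ.1,
    ⟨(RelIso.ofSurjective (OrderEmbedding.ofMapLEIff F fun _ _ => hF) hsurj).symm⟩⟩
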